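/- For any positive integer t with ω = exp(2πi/t), ∑ over n ∈ ℤ^t with n·1 = 0 of ω^{b_t·n} q^{(1/2) n·n} = E(q)^t / E(q^t), where E(q) = ∏_{n≥1}(1-q^n), b_t = (0,1,...,t-1), and |q| < 1. -/

import Mathlib

/-- `E(q) = ∏_{n ≥ 1} (1 - qⁿ)`. -/
noncomputable def Eprod (q : ℂ) : ℂ := ∏' n : ℕ, (1 - q ^ (n + 1))

open Polynomial Filter Topology

/-- The finite product `∏_{1 ≤ i ≤ n} (1 - qⁱ)`. -/
noncomputable def qFactorial (q : ℂ) (n : ℕ) : ℂ := ∏ i ∈ Finset.range n, (1 - q ^ (i + 1))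

/-- The Gaussian binomial coefficient, as a quotient of products `∏ (1 - qⁱ)`. -/
noncomputable def gaussBinom (q : ℂ) (m k : ℕ) : ℂ :=
  if k ≤ m then qFactorial q m / (qFactorial q k * qFactorial q (m - k)) else 0

section Finite

variable {q : ℂ}

lemma one_sub_pow_succ_ne_zero (hq : ‖q‖ < 1) (n : ℕ) : 1 - q ^ (n + 1) ≠ 0 := by
  intro h
  have h1 : ‖q ^ (n + 1)‖ = 1 := by rw [← sub_eq_zero.mp h, norm_one]
  rw [norm_pow] at h1
  exact (pow_lt_one₀ (norm_nonneg q) hq n.succ_ne_zero).ne h1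

lemma qFactorial_ne_zero (hq : ‖q‖ < 1) (n : ℕ) : qFactorial q n ≠ 0 :=
  Finset.prod_ne_zero_iff.mpr fun i _ ↦ one_sub_pow_succ_ne_zero hq i

lemma qFactorial_succ (q : ℂ) (n : ℕ) :
    qFactorial q (n + 1) = qFactorial q n * (1 - q ^ (n + 1)) :=
  Finset.prod_range_succ _ _

lemma gaussBinom_zero_right (hq : ‖q‖ < 1) (m : ℕ) : gaussBinom q m 0 = 1 := by
  have := qFactorial_ne_zero hq m
  have h0 : qFactorial q 0 = 1 := by simp [qFactorial]
  simp [gaussBinom, h0, this]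

lemma gaussBinom_succ_succ (hq : ‖q‖ < 1) (m k : ℕ) :
    gaussBinom q (m + 1) (k + 1) =
      gaussBinom q m (k + 1) + q ^ (m - k) * gaussBinom q m k := by
  rcases lt_trichotomy k m with h | rfl | h
  · obtain ⟨d, rfl⟩ := Nat.exists_eq_add_of_lt h
    have e1 : k + d + 1 + 1 - (k + 1) = d + 1 := by omega
    have e2 : k + d + 1 - (k + 1) = d := by omega
    have e3 : k + d + 1 - k = d + 1 := by omega
    have l1 : k + 1 ≤ k + d + 1 + 1 := by omega
    have l2 : k + 1 ≤ k + d + 1 := by omega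
    have l3 : k ≤ k + d + 1 := by omega
    have h1 := qFactorial_ne_zero hq k
    have h2 := qFactorial_ne_zero hq d
    have h3 := one_sub_pow_succ_ne_zero hq k
    have h4 := one_sub_pow_succ_ne_zero hq d
    simp only [gaussBinom, l1, l2, l3, if_true, e1, e2, e3, qFactorial_succ q (k + d + 1),
      qFactorial_succ q k, qFactorial_succ q d]
    field_simp
    ring
  · have h1 := qFactorial_ne_zero hq k
    have h2 := qFactorial_ne_zero hq (k + 1)
    have h0 : qFactorial q 0 = 1 := by simp [qFactorial]
    simp [gaussBinom, h0, h1, h2]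
  · simp [gaussBinom, h.not_ge, show ¬ k + 1 ≤ m by omega]

lemma coeff_prod_one_add (hq : ‖q‖ < 1) (a : ℂ) (m k : ℕ) :
    (∏ i ∈ Finset.range m, (1 + C (a * q ^ i) * X)).coeff k =
      gaussBinom q m k * q ^ k.choose 2 * a ^ k := by
  induction m generalizing k with
  | zero =>
    cases k with
    | zero => simp [gaussBinom, qFactorial]
    | succ k => simp [gaussBinom, coeff_one]
  | succ m ih =>
    rw [Finset.prod_range_succ, mul_add, mul_one, coeff_add, ← mul_assoc, mul_right_comm]
    cases k with
    | zero =>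
      rw [mul_right_comm, mul_coeff_zero, coeff_X_zero, mul_zero, add_zero, ih,
        gaussBinom_zero_right hq, gaussBinom_zero_right hq]
    | succ k =>
      rw [coeff_mul_C, coeff_mul_X, ih, ih, gaussBinom_succ_succ hq, Nat.choose_succ_succ' k 1,
        Nat.choose_one_right]
      by_cases h : k ≤ m
      · obtain ⟨d, rfl⟩ := Nat.exists_eq_add_of_le h
        rw [Nat.add_sub_cancel_left]
        ring
      · simp only [gaussBinom, h, show ¬ k + 1 ≤ m by omega, if_false]
        ring

/-- The finite `q`-binomial theorem. -/
lemma prod_one_add_eq_sum (hq : ‖q‖ < 1) (a : ℂ) (m : ℕ) :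
    ∏ i ∈ Finset.range m, (1 + C (a * q ^ i) * X) =
      ∑ k ∈ Finset.range (m + 1), C (gaussBinom q m k * q ^ k.choose 2 * a ^ k) * X ^ k := by
  ext n
  rw [coeff_prod_one_add hq, finsetSum_coeff]
  simp only [coeff_C_mul, coeff_X_pow, mul_ite, mul_one, mul_zero]
  rw [Finset.sum_ite_eq]
  split_ifs with h
  · rfl
  · simp [gaussBinom, show ¬ n ≤ m by simpa using h]

lemma prod_sub_pow_mul {R : Type*} [CommRing R] [IsDomain R] {ζ : R} {t : ℕ}
    (hζ : IsPrimitiveRoot ζ t) (ht : 0 < t) (x y : R) :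
    ∏ j : Fin t, (x - ζ ^ (j : ℕ) * y) = x ^ t - y ^ t := by
  classical
  rw [hζ.pow_sub_pow_eq_prod_sub_mul x y ht, Fin.prod_univ_eq_prod_range
    (fun j ↦ x - ζ ^ j * y) t, nthRootsFinset, hζ.nthRoots_eq (one_pow t)]
  have hinj : Set.InjOn (fun j ↦ ζ ^ j) (Finset.range t) := by
    simpa using hζ.injOn_pow
  rw [← Finset.prod_image (f := fun z ↦ x - z * y) hinj]
  congr 1
  ext z
  simp

lemma prod_neg_pow {ζ : ℂ} {t : ℕ} (hζ : IsPrimitiveRoot ζ t) (ht : 0 < t) :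
    ∏ j : Fin t, (-ζ ^ (j : ℕ)) = -1 := by
  simpa [ht.ne'] using prod_sub_pow_mul hζ ht 0 1

/-- Comparing the coefficients of `X ^ (t * n)` in the two expansions of
`∏ j < t, ∏ i < m, (1 - ζʲ qⁱ X) = ∏ i < m, (1 - qⁱᵗ Xᵗ)`. -/
lemma sum_gaussBinom_eq {ζ : ℂ} {t : ℕ} (hζ : IsPrimitiveRoot ζ t) (ht : 0 < t)
    (hq : ‖q‖ < 1) (m n : ℕ) :
    ∑ k ∈ Fintype.piFinset (fun _ : Fin t ↦ Finset.range (m + 1)) with ∑ i, k i = t * n,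
        ∏ i, (gaussBinom q m (k i) * q ^ (k i).choose 2 * (-ζ ^ (i : ℕ)) ^ k i) =
      gaussBinom (q ^ t) m n * (q ^ t) ^ n.choose 2 * (-1) ^ n := by
  have hqt : ‖q ^ t‖ < 1 := by
    rw [norm_pow]; exact pow_lt_one₀ (norm_nonneg q) hq ht.ne'
  have key : ∏ j : Fin t, ∏ i ∈ Finset.range m, (1 + C (-ζ ^ (j : ℕ) * q ^ i) * X) =
      expand ℂ t (∏ i ∈ Finset.range m, (1 + C (-1 * (q ^ t) ^ i) * X)) := by
    rw [Finset.prod_comm, map_prod]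
    refine Finset.prod_congr rfl fun i _ ↦ ?_
    have := prod_sub_pow_mul (hζ.map_of_injective (f := (C : ℂ →+* ℂ[X])) C_injective) ht 1
      (C (q ^ i) * X)
    rw [one_pow, mul_pow, ← C_pow, pow_right_comm] at this
    simp only [map_add, map_one, map_mul, expand_C, expand_X]
    simp only [map_neg, map_one, neg_mul, one_mul, ← sub_eq_add_neg]
    rw [← this]
    refine Finset.prod_congr rfl fun j _ ↦ ?_
    simp [mul_assoc, sub_eq_add_neg]
  have := congrArg (fun p ↦ p.coeff (t * n)) key
  simp only [coeff_expand_mul' ht, coeff_prod_one_add hqt] at this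
  rw [← this]
  simp only [prod_one_add_eq_sum hq]
  rw [Finset.prod_univ_sum, finsetSum_coeff, Finset.sum_filter]
  refine Finset.sum_congr rfl fun k _ ↦ ?_
  rw [Finset.prod_mul_distrib (f := fun i ↦ C _), ← map_prod, Finset.prod_pow_eq_pow_sum,
    coeff_C_mul, coeff_X_pow, mul_ite, mul_one, mul_zero]
  simp only [eq_comm]

end Finite

section Limits

variable {q : ℂ}

lemma summable_norm_neg_pow_succ (hq : ‖q‖ < 1) : Summable fun n : ℕ ↦ ‖-q ^ (n + 1)‖ := by
  simp only [norm_neg, norm_pow]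
  exact (summable_nat_add_iff 1).mpr (summable_geometric_of_lt_one (norm_nonneg q) hq)

lemma tendsto_qFactorial (hq : ‖q‖ < 1) : Tendsto (qFactorial q) atTop (𝓝 (Eprod q)) := by
  have := (multipliable_one_add_of_summable
    (summable_norm_neg_pow_succ hq)).tendsto_prod_tprod_nat
  simp only [← sub_eq_add_neg] at this
  exact this

lemma Eprod_ne_zero (hq : ‖q‖ < 1) : Eprod q ≠ 0 := by
  have := tprod_one_add_ne_zero_of_summable (f := fun n : ℕ ↦ -q ^ (n + 1))
    (fun i ↦ by simpa only [← sub_eq_add_neg] using one_sub_pow_succ_ne_zero hq i)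
    (summable_norm_neg_pow_succ hq)
  simp only [← sub_eq_add_neg] at this
  exact this

lemma exists_norm_gaussBinom_le (hq : ‖q‖ < 1) :
    ∃ B : ℝ, ∀ m k, ‖gaussBinom q m k‖ ≤ B := by
  obtain ⟨B, hB⟩ := (tendsto_qFactorial hq).norm.bddAbove_range
  obtain ⟨D, hD⟩ := ((tendsto_qFactorial hq).inv₀ (Eprod_ne_zero hq)).norm.bddAbove_range
  have hB' : ∀ n, ‖qFactorial q n‖ ≤ B := fun n ↦ hB ⟨n, rfl⟩
  have hD' : ∀ n, ‖(qFactorial q n)⁻¹‖ ≤ D := fun n ↦ hD ⟨n, rfl⟩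
  have hB0 : 0 ≤ B := (norm_nonneg _).trans (hB' 0)
  have hD0 : 0 ≤ D := (norm_nonneg _).trans (hD' 0)
  refine ⟨B * (D * D), fun m k ↦ ?_⟩
  unfold gaussBinom
  split_ifs
  · rw [div_eq_mul_inv, mul_inv, norm_mul, norm_mul]
    gcongr
    exacts [hB' _, hD' _, hD' _]
  · rw [norm_zero]; positivity

lemma tendsto_gaussBinom_central (hq : ‖q‖ < 1) (a : ℤ) :
    Tendsto (fun N : ℕ ↦ gaussBinom q (2 * N) (N + a).toNat) atTop (𝓝 (Eprod q)⁻¹) := by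
  have hE := Eprod_ne_zero hq
  have h1 : Tendsto (fun N : ℕ ↦ 2 * N) atTop atTop :=
    tendsto_atTop_mono (fun N ↦ Nat.le_mul_of_pos_left N two_pos) tendsto_id
  have h2 : Tendsto (fun N : ℕ ↦ (N + a).toNat) atTop atTop :=
    tendsto_atTop_mono (fun N ↦ by show N - a.natAbs ≤ _; omega)
      (tendsto_sub_atTop_nat a.natAbs)
  have h3 : Tendsto (fun N : ℕ ↦ 2 * N - (N + a).toNat) atTop atTop :=
    tendsto_atTop_mono (fun N ↦ by show N - a.natAbs ≤ _; omega)
      (tendsto_sub_atTop_nat a.natAbs)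
  have hP := tendsto_qFactorial hq
  have := (hP.comp h1).div ((hP.comp h2).mul (hP.comp h3)) (mul_ne_zero hE hE)
  rw [div_mul_cancel_left₀ hE] at this
  refine this.congr' ?_
  filter_upwards [eventually_ge_atTop a.natAbs] with N hN
  simp [gaussBinom, show (N + a).toNat ≤ 2 * N by omega]

end Limits

section Lattice

/-- Half of the squared length of an integer vector. -/
def halfNormSq {t : ℕ} (v : Fin t → ℤ) : ℕ := (∑ i, (v i).natAbs ^ 2) / 2

lemma sum_sq_ediv_two {t : ℕ} (v : Fin t → ℤ) :
    (∑ i, (v i) ^ 2) / 2 = (halfNormSq v : ℤ) := by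
  simp [halfNormSq]

lemma two_mul_halfNormSq {t : ℕ} {v : Fin t → ℤ} (hv : ∑ i, v i = 0) :
    2 * halfNormSq v = ∑ i, (v i).natAbs ^ 2 := by
  refine Nat.mul_div_cancel' ?_
  zify
  simp only [sq_abs]
  rw [← sub_zero (∑ i, v i ^ 2), ← hv, ← Finset.sum_sub_distrib]
  refine Finset.dvd_sum fun i _ ↦ ?_
  rw [show v i ^ 2 - v i = (v i - 1) * (v i - 1 + 1) by ring]
  exact (Int.even_mul_succ_self _).two_dvd

lemma sum_choose_two {t N : ℕ} {v : Fin t → ℤ} (hv : ∑ i, v i = 0) {k : Fin t → ℕ}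
    (hk : ∀ i, (k i : ℤ) = N + v i) :
    ∑ i, (k i).choose 2 = t * N.choose 2 + halfNormSq v := by
  have hc (n : ℕ) : (2 * n.choose 2 : ℤ) = n ^ 2 - n := by
    have := Nat.cast_choose_two ℚ n
    qify
    rw [this]
    ring
  have h2 := two_mul_halfNormSq hv
  zify at h2 ⊢
  simp only [sq_abs] at h2
  refine mul_left_cancel₀ (two_ne_zero (α := ℤ)) ?_
  rw [Finset.mul_sum, mul_add, h2, mul_left_comm]
  simp only [hc, hk]
  have (i : Fin t) : ((N : ℤ) + v i) ^ 2 - (N + v i) = (N ^ 2 - N) + ((2 * N - 1) * v i + v i ^ 2) := by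
    ring
  simp only [this, Finset.sum_add_distrib, ← Finset.mul_sum, hv]
  simp
  ring

lemma zpow_sum₀ {ι K : Type*} [Field K] {a : K} (ha : a ≠ 0) (s : Finset ι) (f : ι → ℤ) :
    a ^ (∑ i ∈ s, f i) = ∏ i ∈ s, a ^ f i := by
  classical
  induction s using Finset.induction_on with
  | empty => simp
  | insert i s hi ih => rw [Finset.sum_insert hi, Finset.prod_insert hi, zpow_add₀ ha, ih]

lemma summable_pow_natAbs_sq {x : ℝ} (hx0 : 0 ≤ x) (hx : x < 1) :
    Summable fun n : ℤ ↦ x ^ (n.natAbs ^ 2) := by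
  have h : Summable fun n : ℕ ↦ x ^ (n ^ 2) :=
    (summable_geometric_of_lt_one hx0 hx).of_nonneg_of_le (fun n ↦ by positivity)
      fun n ↦ pow_le_pow_of_le_one hx0 hx.le (Nat.le_self_pow two_ne_zero n)
  exact .of_nat_of_neg (by simpa using h) (by simpa using h)

lemma summable_pi_prod {ι α : Type*} [Fintype ι] {f : α → ℝ} (hf0 : 0 ≤ f)
    (hf : Summable f) : Summable fun v : ι → α ↦ ∏ i, f (v i) := by
  classical
  refine summable_of_sum_le (c := (∑' a, f a) ^ Fintype.card ι)
    (fun v ↦ Finset.prod_nonneg fun i _ ↦ hf0 _) fun s ↦ ?_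
  calc ∑ v ∈ s, ∏ i, f (v i)
      ≤ ∑ v ∈ Fintype.piFinset fun i ↦ s.image (· i), ∏ i, f (v i) := by
        refine Finset.sum_le_sum_of_subset_of_nonneg (fun v hv ↦ ?_)
          fun v _ _ ↦ Finset.prod_nonneg fun i _ ↦ hf0 _
        exact Fintype.mem_piFinset.mpr fun i ↦ Finset.mem_image_of_mem _ hv
    _ = ∏ i, ∑ a ∈ s.image (· i), f a := (Finset.prod_univ_sum _ _).symm
    _ ≤ ∏ _i : ι, ∑' a, f a := by
        refine Finset.prod_le_prod (fun i _ ↦ Finset.sum_nonneg fun a _ ↦ hf0 a) fun i _ ↦ ?_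
        exact hf.sum_le_tsum _ fun a _ ↦ hf0 a
    _ = (∑' a, f a) ^ Fintype.card ι := by simp

end Lattice

section Identity

/-- The truncated lattice sum over the box `[-N, N]ᵗ`, with Gaussian binomial weights. -/
noncomputable def boxTerm (q ζ : ℂ) (t N : ℕ) (v : Fin t → ℤ) : ℂ :=
  if ∀ i, (v i).natAbs ≤ N then
    (∏ i, gaussBinom q (2 * N) (N + v i).toNat) *
      (ζ ^ (∑ i, (i.1 : ℤ) * v i) * q ^ halfNormSq v)
  else 0

variable {q ζ : ℂ} {t : ℕ}

lemma prod_neg_pow_pow (hζ : IsPrimitiveRoot ζ t) (ht : 0 < t) {N : ℕ} {v : Fin t → ℤ}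
    (hv : ∑ i, v i = 0) {k : Fin t → ℕ} (hk : ∀ i, (k i : ℤ) = N + v i) :
    ∏ i : Fin t, (-ζ ^ (i : ℕ)) ^ k i = (-1) ^ N * ζ ^ (∑ i, (i.1 : ℤ) * v i) := by
  have hζ0 : ζ ≠ 0 := hζ.ne_zero ht.ne'
  have (i : Fin t) : (-ζ ^ (i : ℕ)) ^ k i =
      (-ζ ^ (i : ℕ)) ^ N * ((-1) ^ v i * ζ ^ ((i.1 : ℤ) * v i)) := by
    rw [← zpow_natCast _ (k i), hk, zpow_add₀ (neg_ne_zero.mpr (pow_ne_zero _ hζ0)),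
      zpow_natCast, zpow_mul, zpow_natCast, ← mul_zpow, neg_one_mul]
  simp only [this, Finset.prod_mul_distrib, Finset.prod_pow, prod_neg_pow hζ ht]
  rw [← zpow_sum₀ (by simp), hv, zpow_zero, one_mul, zpow_sum₀ hζ0]

lemma tsum_boxTerm (hζ : IsPrimitiveRoot ζ t) (ht : 0 < t) (hq : ‖q‖ < 1) (hq0 : q ≠ 0)
    (N : ℕ) :
    ∑' v : {v : Fin t → ℤ // ∑ i, v i = 0}, boxTerm q ζ t N v =
      gaussBinom (q ^ t) (2 * N) N := by
  classical
  have hc : (q ^ t) ^ N.choose 2 * (-1) ^ N ≠ 0 := by simp [hq0]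
  refine mul_right_cancel₀ hc ?_
  rw [← mul_assoc (gaussBinom _ _ _), ← sum_gaussBinom_eq hζ ht hq (2 * N) N,
    tsum_eq_sum (s := (Fintype.piFinset fun _ : Fin t ↦
      Finset.Icc (-(N : ℤ)) N).subtype fun v ↦ ∑ i, v i = 0), Finset.sum_mul]
  · refine Finset.sum_bij' (fun v _ i ↦ (N + v.1 i).toNat)
      (fun k hk ↦ ⟨fun i ↦ (k i : ℤ) - N, ?_⟩) ?_ ?_ ?_ ?_ ?_
    · have := (Finset.mem_filter.mp hk).2
      rw [Finset.sum_sub_distrib, ← Nat.cast_sum, this]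
      simp
    · rintro ⟨v, hv⟩ hmem
      simp only [Finset.mem_subtype, Fintype.mem_piFinset, Finset.mem_Icc] at hmem
      simp only [Finset.mem_filter, Fintype.mem_piFinset, Finset.mem_range]
      refine ⟨fun i ↦ by have := hmem i; omega, ?_⟩
      zify
      have (i : Fin t) : (((N + v i).toNat : ℕ) : ℤ) = N + v i := by have := hmem i; omega
      simp only [this, Finset.sum_add_distrib, hv]
      simp
    · intro k hk
      simp only [Finset.mem_filter, Fintype.mem_piFinset, Finset.mem_range] at hk
      simp only [Finset.mem_subtype, Fintype.mem_piFinset, Finset.mem_Icc]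
      intro i
      have := hk.1 i
      omega
    · rintro ⟨v, hv⟩ hmem
      simp only [Finset.mem_subtype, Fintype.mem_piFinset, Finset.mem_Icc] at hmem
      ext i
      have := hmem i
      simp only
      omega
    · intro k hk
      ext i
      simp
    · rintro ⟨v, hv⟩ hmem
      simp only [Finset.mem_subtype, Fintype.mem_piFinset, Finset.mem_Icc] at hmem
      have hk (i : Fin t) : (((N + v i).toNat : ℕ) : ℤ) = N + v i := by have := hmem i; omega
      have hbox : ∀ i, (v i).natAbs ≤ N := fun i ↦ by have := hmem i; omega
      rw [boxTerm, if_pos hbox]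
      simp only [Finset.prod_mul_distrib, Finset.prod_pow_eq_pow_sum]
      rw [prod_neg_pow_pow hζ ht hv hk, sum_choose_two hv hk, pow_add, pow_mul]
      ring
  · intro v hv
    refine if_neg fun h ↦ hv ?_
    simp only [Finset.mem_subtype, Fintype.mem_piFinset, Finset.mem_Icc]
    intro i
    have := h i
    omega

lemma norm_pow_halfNormSq {v : Fin t → ℤ} (hv : ∑ i, v i = 0) :
    ‖q ^ halfNormSq v‖ = ∏ i, √‖q‖ ^ (v i).natAbs ^ 2 := by
  rw [Finset.prod_pow_eq_pow_sum, ← two_mul_halfNormSq hv, pow_mul,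
    Real.sq_sqrt (norm_nonneg q), norm_pow]

lemma norm_boxTerm_le (hζ : IsPrimitiveRoot ζ t) (ht : 0 < t) {B : ℝ}
    (hB : ∀ m k, ‖gaussBinom q m k‖ ≤ B) (N : ℕ) {v : Fin t → ℤ} (hv : ∑ i, v i = 0) :
    ‖boxTerm q ζ t N v‖ ≤ B ^ t * ∏ i, √‖q‖ ^ (v i).natAbs ^ 2 := by
  have hB0 : 0 ≤ B := (norm_nonneg _).trans (hB 0 0)
  unfold boxTerm
  split_ifs
  · rw [norm_mul, norm_mul, norm_zpow, hζ.norm'_eq_one ht.ne', one_zpow, one_mul,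
      norm_pow_halfNormSq hv, norm_prod]
    gcongr
    simpa using Finset.prod_le_prod (s := Finset.univ) (fun (i : Fin t) _ ↦ norm_nonneg _)
      fun i _ ↦ hB (2 * N) (N + v i).toNat
  · rw [norm_zero]; positivity

lemma tendsto_boxTerm (hq : ‖q‖ < 1) (v : Fin t → ℤ) :
    Tendsto (fun N ↦ boxTerm q ζ t N v) atTop
      (𝓝 ((Eprod q)⁻¹ ^ t * (ζ ^ (∑ i, (i.1 : ℤ) * v i) * q ^ halfNormSq v))) := by
  have h := (tendsto_finsetProd Finset.univ fun i _ ↦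
    tendsto_gaussBinom_central hq (v i)).mul_const (ζ ^ (∑ i, (i.1 : ℤ) * v i) * q ^ halfNormSq v)
  simp only [Finset.prod_const, Finset.card_univ, Fintype.card_fin] at h
  refine h.congr' ?_
  have : ∀ᶠ N in atTop, ∀ i, (v i).natAbs ≤ N :=
    eventually_all.mpr fun i ↦ eventually_ge_atTop _
  filter_upwards [this] with N hN
  rw [boxTerm, if_pos hN]

lemma tsum_lattice (hζ : IsPrimitiveRoot ζ t) (ht : 0 < t) (hq : ‖q‖ < 1) (hq0 : q ≠ 0) :
    ∑' v : {v : Fin t → ℤ // ∑ i, v i = 0},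
        ζ ^ (∑ i, (i.1 : ℤ) * v.1 i) * q ^ halfNormSq v.1 = Eprod q ^ t / Eprod (q ^ t) := by
  have hqt : ‖q ^ t‖ < 1 := by
    rw [norm_pow]; exact pow_lt_one₀ (norm_nonneg q) hq ht.ne'
  obtain ⟨B, hB⟩ := exists_norm_gaussBinom_le hq
  have hsum : Summable fun v : {v : Fin t → ℤ // ∑ i, v i = 0} ↦
      B ^ t * ∏ i, √‖q‖ ^ (v.1 i).natAbs ^ 2 :=
    ((summable_pi_prod (fun n ↦ by positivity) (summable_pow_natAbs_sq (Real.sqrt_nonneg _)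
      (by rwa [Real.sqrt_lt' one_pos, one_pow]))).subtype _).mul_left _
  have h1 := tendsto_tsum_of_dominated_convergence hsum
    (fun v ↦ tendsto_boxTerm (ζ := ζ) hq v.1)
    (Eventually.of_forall fun N v ↦ norm_boxTerm_le hζ ht hB N v.2)
  simp only [tsum_boxTerm hζ ht hq hq0, tsum_mul_left] at h1
  have h2 := tendsto_gaussBinom_central hqt 0
  simp only [add_zero, Int.toNat_natCast] at h2
  have h3 := tendsto_nhds_unique h1 h2
  have hE := Eprod_ne_zero hq
  rw [div_eq_mul_inv, ← h3, ← mul_assoc, ← mul_pow, mul_inv_cancel₀ hE, one_pow, one_mul]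

lemma tsum_lattice_zero (ht : 0 < t) :
    ∑' v : {v : Fin t → ℤ // ∑ i, v i = 0},
        ζ ^ (∑ i, (i.1 : ℤ) * v.1 i) * (0 : ℂ) ^ halfNormSq v.1 =
      Eprod 0 ^ t / Eprod (0 ^ t) := by
  have hE : Eprod 0 = 1 := by simp [Eprod]
  rw [tsum_eq_single ⟨0, by simp⟩]
  · simp [hE, ht.ne', halfNormSq]
  · rintro ⟨v, hv⟩ hne
    have : halfNormSq v ≠ 0 := by
      intro h
      have h2 := two_mul_halfNormSq hv
      rw [h, mul_zero, eq_comm, Finset.sum_eq_zero_iff] at h2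
      exact hne (Subtype.ext (funext fun i ↦ by simpa using h2 i (Finset.mem_univ i)))
    simp [this]

end Identity

/-- For any positive integer `t`, with `ω = exp(2πi/t)`,
`∑_{n ∈ ℤᵗ, n·1 = 0} ω^{b_t·n} q^{(1/2) n·n} = E(q)^t / E(q^t)`,
where `b_t = (0,1,…,t-1)` and `n·n` is even on the hyperplane `n·1 = 0`
(so `q^{(1/2) n·n}` is written via exact integer division). -/
theorem conjugate_klyachko_identity (t : ℕ) (ht : 0 < t) (q : ℂ) (hq : ‖q‖ < 1) :
    ∑' v : {v : Fin t → ℤ // ∑ i, v i = 0},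
        (Complex.exp (2 * Real.pi * Complex.I / t)) ^ (∑ i, (i.1 : ℤ) * v.1 i) *
          q ^ ((∑ i, (v.1 i) ^ 2) / 2) =
      Eprod q ^ t / Eprod (q ^ t) := by
  have hζ := Complex.isPrimitiveRoot_exp t ht.ne'
  simp only [sum_sq_ediv_two, zpow_natCast]
  rcases eq_or_ne q 0 with rfl | hq0
  · exact tsum_lattice_zero ht
  · exact tsum_lattice hζ ht hq hq0
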